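/- There exists a constant C > 0 such that for every integer n ≥ 1, the sum S_n = (1/n) · ∑_{k=1}^∞ log(1 + k/n) / ((1 + k/n)(1 + (k−1)/n)) converges and satisfies |S_n − 1| ≤ C/n. -/

import Mathlib

open MeasureTheory Filter

/-- The increment of `t ↦ -(log t + 1) / t`, an antiderivative of `log t / t ^ 2`, over `[a, b]` is
at most the sampled value `(b - a) * (log b / (b * a))`. -/
lemma sub_log_add_one_div_le {a b : ℝ} (ha : 0 < a) (hab : a ≤ b) :
    (Real.log a + 1) / a - (Real.log b + 1) / b ≤ (b - a) * (Real.log b / (b * a)) := by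
  have hb : 0 < b := ha.trans_le hab
  have h := Real.one_sub_inv_le_log_of_pos (div_pos hb ha)
  rw [Real.log_div hb.ne' ha.ne', inv_div] at h
  have key : (b - a) * (Real.log b / (b * a)) - ((Real.log a + 1) / a - (Real.log b + 1) / b)
      = (Real.log b - Real.log a - (1 - a / b)) / a := by
    field_simp
    ring
  have := div_nonneg (sub_nonneg.2 h) ha.le
  linarith

/-- The sampled value `(b - a) * (log b / (b * a))` exceeds the increment of `t ↦ -(log t + 1) / t`
over `[a, b]` by at most `(b - a) * (1 / a - 1 / b)`. -/
lemma mul_log_div_le {a b : ℝ} (ha : 1 ≤ a) (hab : a ≤ b) :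
    (b - a) * (Real.log b / (b * a)) ≤
      (Real.log a + 1) / a - (Real.log b + 1) / b + (b - a) * (1 / a - 1 / b) := by
  have ha0 : 0 < a := by linarith
  have hb : 0 < b := ha0.trans_le hab
  have h := Real.log_le_sub_one_of_pos (div_pos hb ha0)
  rw [Real.log_div hb.ne' ha0.ne'] at h
  have key : (Real.log a + 1) / a - (Real.log b + 1) / b + (b - a) * (1 / a - 1 / b)
      - (b - a) * (Real.log b / (b * a))
      = (b / a - 1 - (Real.log b - Real.log a)) / a + (b - a) ^ 2 * (a - 1) / (a ^ 2 * b) := by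
    field_simp
    ring
  have h₁ := div_nonneg (sub_nonneg.2 h) ha0.le
  have h₂ : 0 ≤ (b - a) ^ 2 * (a - 1) / (a ^ 2 * b) :=
    div_nonneg (mul_nonneg (sq_nonneg _) (sub_nonneg.2 ha)) (by positivity)
  linarith

lemma tendsto_log_add_one_div_atTop :
    Tendsto (fun t : ℝ => (Real.log t + 1) / t) atTop (nhds 0) := by
  have h₁ : Tendsto (fun t : ℝ => Real.log t / t) atTop (nhds 0) :=
    Real.isLittleO_log_id_atTop.tendsto_div_nhds_zero
  simpa [add_div] using h₁.add tendsto_inv_atTop_zero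

/-- There is a constant `C > 0` such that for every `n ≥ 1` the series
`S n = (1/n) * ∑_{k ≥ 1} log (1 + k/n) / ((1 + k/n) * (1 + (k-1)/n))` converges and
`|S n - 1| ≤ C / n`. The sum over `k ≥ 1` is written via the shift `k ↦ k + 1`. -/
theorem conditional_log_ratio_sum_near_one :
    ∃ C > (0 : ℝ), ∀ n : ℕ, 1 ≤ n →
      Summable (fun k : ℕ => Real.log (1 + ((k : ℝ) + 1) / n) /
          ((1 + ((k : ℝ) + 1) / n) * (1 + (k : ℝ) / n))) ∧
        |(1 / (n : ℝ)) * (∑' k : ℕ, Real.log (1 + ((k : ℝ) + 1) / n) /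
            ((1 + ((k : ℝ) + 1) / n) * (1 + (k : ℝ) / n))) - 1| ≤ C / n := by
  refine ⟨1, one_pos, fun n hn => ?_⟩
  have hn0 : (0 : ℝ) < n := by exact_mod_cast hn
  set f : ℕ → ℝ := fun k => Real.log (1 + ((k : ℝ) + 1) / n) /
    ((1 + ((k : ℝ) + 1) / n) * (1 + (k : ℝ) / n)) with hf
  set g : ℝ → ℝ := fun t => (Real.log t + 1) / t with hg
  set a : ℕ → ℝ := fun k => 1 + (k : ℝ) / n with ha
  have ha1 (k : ℕ) : 1 ≤ a k := le_add_of_nonneg_right (by positivity)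
  have hstep (k : ℕ) : a (k + 1) - a k = 1 / n := by
    simp only [ha]
    push_cast
    ring
  have hmono (k : ℕ) : a k ≤ a (k + 1) := sub_nonneg.1 (by rw [hstep]; positivity)
  have hfa (k : ℕ) : f k = Real.log (a (k + 1)) / (a (k + 1) * a k) := by
    simp only [hf, ha, Nat.cast_add, Nat.cast_one]
  have hf0 (k : ℕ) : 0 ≤ f k := by
    rw [hfa]
    have h₁ := ha1 k
    have h₂ := ha1 (k + 1)
    exact div_nonneg (Real.log_nonneg h₂) (by positivity)
  have ha0 : a 0 = 1 := by simp [ha]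
  have hg1 : g 1 = 1 := by simp [hg]
  have lower (N : ℕ) : 1 - g (a N) ≤ 1 / n * ∑ k ∈ Finset.range N, f k := by
    have h : ∑ k ∈ Finset.range N, (g (a k) - g (a (k + 1)))
        ≤ ∑ k ∈ Finset.range N, 1 / n * f k := Finset.sum_le_sum fun k _ => by
      rw [hfa, ← hstep k]
      exact sub_log_add_one_div_le (by linarith [ha1 k]) (hmono k)
    rwa [Finset.sum_range_sub' (fun k => g (a k)), ← Finset.mul_sum, ha0, hg1] at h
  have upper (N : ℕ) : 1 / n * ∑ k ∈ Finset.range N, f k ≤ 1 + 1 / n := by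
    have h : ∑ k ∈ Finset.range N, 1 / n * f k ≤ ∑ k ∈ Finset.range N,
        ((g (a k) - g (a (k + 1))) + 1 / n * (1 / a k - 1 / a (k + 1))) :=
      Finset.sum_le_sum fun k _ => by
        rw [hfa, ← hstep k]
        exact mul_log_div_le (ha1 k) (hmono k)
    rw [Finset.sum_add_distrib, Finset.sum_range_sub' (fun k => g (a k)), ← Finset.mul_sum,
      ← Finset.mul_sum, Finset.sum_range_sub' (fun k => 1 / a k), ha0, hg1] at h
    have hN := ha1 N
    have h₁ : 0 ≤ g (a N) := div_nonneg (by linarith [Real.log_nonneg hN]) (by linarith)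
    have h₂ : 1 / (n : ℝ) * (1 / 1 - 1 / a N) ≤ 1 / n :=
      mul_le_of_le_one_right (by positivity) (by simp; linarith)
    linarith
  have hsum : Summable f := summable_of_sum_range_le (c := n * (1 + 1 / n)) hf0 fun N => by
    have := mul_le_mul_of_nonneg_left (upper N) hn0.le
    rwa [← mul_assoc, mul_one_div_cancel hn0.ne', one_mul] at this
  refine ⟨hsum, ?_⟩
  have hlim : Tendsto (fun N => 1 / (n : ℝ) * ∑ k ∈ Finset.range N, f k) atTop
      (nhds (1 / n * ∑' k, f k)) := hsum.hasSum.tendsto_sum_nat.const_mul _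
  have haT : Tendsto a atTop atTop :=
    tendsto_atTop_add_const_left _ _ (tendsto_natCast_atTop_atTop.atTop_div_const hn0)
  have hgT : Tendsto (fun N => 1 - g (a N)) atTop (nhds (1 - 0)) :=
    (tendsto_log_add_one_div_atTop.comp haT).const_sub 1
  have h₁ := le_of_tendsto_of_tendsto' hgT hlim lower
  have h₂ := le_of_tendsto' hlim upper
  have h₃ : 0 ≤ 1 / (n : ℝ) := by positivity
  exact abs_le.2 ⟨by linarith, by linarith⟩
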